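/- Let X = MD(G, S0, S1, T0, T1) be a strongly connected mixed Cayley digraph with λ(X) < δ(X), and let A be a λ-atom of X. Write A ∩ X_i = H_i × {i} with H_i ⊆ G for i = 0,1. If (1_G, i) ∈ A, then H_i is a subgroup of G (for i = 0 and i = 1 respectively). -/

import Mathlib

open Set Pointwise

/-- Arc relation of the mixed Cayley digraph `MD(G,S0,S1,T0,T1)` on vertex set
`G × Bool`, where `false` plays the role of the index `0` and `true` of `1`. -/
def MDArc {G : Type*} [Group G] (S0 S1 T0 T1 : Set G) (u v : G × Bool) : Prop :=
  (u.2 = false ∧ v.2 = false ∧ ∃ s ∈ S0, v.1 = s * u.1) ∨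
  (u.2 = true ∧ v.2 = true ∧ ∃ s ∈ S1, v.1 = s * u.1) ∨
  (u.2 = false ∧ v.2 = true ∧ ∃ t ∈ T0, v.1 = t * u.1) ∨
  (u.2 = true ∧ v.2 = false ∧ ∃ t ∈ T1, u.1 = t * v.1)

/-- A digraph (given by its arc relation) is strongly connected if every vertex
is reachable from every other vertex by a directed path. -/
def DigraphStronglyConnected {V : Type*} (R : V → V → Prop) : Prop :=
  ∀ u v : V, Relation.ReflTransGen R u v

/-- Out-degree of a vertex: the number of arcs originating at it. -/
noncomputable def outDegree {V : Type*} (R : V → V → Prop) (v : V) : ℕ :=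
  {w | R v w}.ncard

/-- In-degree of a vertex: the number of arcs terminating at it. -/
noncomputable def inDegree {V : Type*} (R : V → V → Prop) (v : V) : ℕ :=
  {w | R w v}.ncard

/-- `δ`: the minimum, over all vertices, of in-degrees and out-degrees. -/
noncomputable def minDegree {V : Type*} (R : V → V → Prop) : ℕ :=
  sInf {n | ∃ v, n = outDegree R v ∨ n = inDegree R v}

/-- `W` is an arc-disconnecting set: a set of arcs whose deletion leaves a
digraph that is not strongly connected. -/
def IsDisconnectingArcSet {V : Type*} (R : V → V → Prop) (W : Set (V × V)) : Prop :=
  (∀ p ∈ W, R p.1 p.2) ∧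
  ¬ DigraphStronglyConnected (fun u v => R u v ∧ (u, v) ∉ W)

/-- The arc connectivity `λ`: the minimum cardinality of an arc-disconnecting set. -/
noncomputable def arcConnectivity {V : Type*} (R : V → V → Prop) : ℕ :=
  sInf {n | ∃ W : Set (V × V), IsDisconnectingArcSet R W ∧ W.ncard = n}

/-- `ω⁺(A)`: the set of arcs from `A` to its complement. -/
def omegaPlus {V : Type*} (R : V → V → Prop) (A : Set V) : Set (V × V) :=
  {p | R p.1 p.2 ∧ p.1 ∈ A ∧ p.2 ∉ A}

/-- `ω⁻(A)`: the set of arcs from the complement of `A` to `A`. -/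
def omegaMinus {V : Type*} (R : V → V → Prop) (A : Set V) : Set (V × V) :=
  {p | R p.1 p.2 ∧ p.1 ∉ A ∧ p.2 ∈ A}

/-- A positive arc fragment: a proper nonempty vertex subset with `|ω⁺(A)| = λ`. -/
def IsPosFragment {V : Type*} (R : V → V → Prop) (A : Set V) : Prop :=
  A.Nonempty ∧ A ≠ Set.univ ∧ (omegaPlus R A).ncard = arcConnectivity R

/-- A negative arc fragment: a proper nonempty vertex subset with `|ω⁻(A)| = λ`. -/
def IsNegFragment {V : Type*} (R : V → V → Prop) (A : Set V) : Prop :=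
  A.Nonempty ∧ A ≠ Set.univ ∧ (omegaMinus R A).ncard = arcConnectivity R

/-- An arc fragment: a positive or negative arc fragment. -/
def IsArcFragment {V : Type*} (R : V → V → Prop) (A : Set V) : Prop :=
  IsPosFragment R A ∨ IsNegFragment R A

/-- A `λ`-atom: an arc fragment of least possible cardinality. -/
def IsLambdaAtom {V : Type*} (R : V → V → Prop) (A : Set V) : Prop :=
  IsArcFragment R A ∧ ∀ B, IsArcFragment R B → A.ncard ≤ B.ncard

/-- A positive `λ`-atom: a positive arc fragment of least possible cardinality
among all arc fragments. -/
def IsPosLambdaAtom {V : Type*} (R : V → V → Prop) (A : Set V) : Prop :=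
  IsPosFragment R A ∧ ∀ B, IsArcFragment R B → A.ncard ≤ B.ncard

/-- A negative `λ`-atom: a negative arc fragment of least possible cardinality
among all arc fragments. -/
def IsNegLambdaAtom {V : Type*} (R : V → V → Prop) (A : Set V) : Prop :=
  IsNegFragment R A ∧ ∀ B, IsArcFragment R B → A.ncard ≤ B.ncard

/-- A `λ`-superatom: an arc fragment with at least two vertices, of least
possible cardinality among arc fragments with at least two vertices. -/
def IsLambdaSuperatom {V : Type*} (R : V → V → Prop) (A : Set V) : Prop :=
  IsArcFragment R A ∧ 2 ≤ A.ncard ∧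
    ∀ B, IsArcFragment R B → 2 ≤ B.ncard → A.ncard ≤ B.ncard

/-- A positive `λ`-superatom. -/
def IsPosLambdaSuperatom {V : Type*} (R : V → V → Prop) (A : Set V) : Prop :=
  IsPosFragment R A ∧ 2 ≤ A.ncard ∧
    ∀ B, IsArcFragment R B → 2 ≤ B.ncard → A.ncard ≤ B.ncard

/-- A negative `λ`-superatom. -/
def IsNegLambdaSuperatom {V : Type*} (R : V → V → Prop) (A : Set V) : Prop :=
  IsNegFragment R A ∧ 2 ≤ A.ncard ∧
    ∀ B, IsArcFragment R B → 2 ≤ B.ncard → A.ncard ≤ B.ncard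

/-- The set of out-arcs of a vertex. -/
def outArcsOf {V : Type*} (R : V → V → Prop) (v : V) : Set (V × V) :=
  {p | R p.1 p.2 ∧ p.1 = v}

/-- The set of in-arcs of a vertex. -/
def inArcsOf {V : Type*} (R : V → V → Prop) (v : V) : Set (V × V) :=
  {p | R p.1 p.2 ∧ p.2 = v}

/-- A digraph is super-`λ` if every minimum arc-disconnecting set is the set of
in-arcs of some vertex or the set of out-arcs of some vertex. -/
def SuperLambda {V : Type*} (R : V → V → Prop) : Prop :=
  ∀ W : Set (V × V), IsDisconnectingArcSet R W → W.ncard = arcConnectivity R →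
    (∃ v, W = outArcsOf R v) ∨ (∃ v, W = inArcsOf R v)

section Digraph

variable {V : Type*} (R : V → V → Prop)

theorem omegaMinus_eq_omegaPlus_compl (A : Set V) : omegaMinus R A = omegaPlus R Aᶜ := by
  ext p
  simp [omegaMinus, omegaPlus]

theorem omegaPlus_isDisconnecting {A : Set V} (hne : A.Nonempty) (huniv : A ≠ Set.univ) :
    IsDisconnectingArcSet R (omegaPlus R A) := by
  refine ⟨fun p hp => hp.1, fun hconn => ?_⟩
  obtain ⟨u, hu⟩ := hne
  obtain ⟨v, hv⟩ := (Set.ne_univ_iff_exists_notMem A).1 huniv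
  have hclosed : ∀ w, Relation.ReflTransGen
      (fun x y => R x y ∧ (x, y) ∉ omegaPlus R A) u w → w ∈ A := by
    intro w hw
    induction hw with
    | refl => exact hu
    | tail _ hstep ih =>
      by_contra hnot
      exact hstep.2 ⟨hstep.1, ih, hnot⟩
  exact hv (hclosed v (hconn u v))

theorem arcConnectivity_le_ncard_omegaPlus {A : Set V} (hne : A.Nonempty)
    (huniv : A ≠ Set.univ) : arcConnectivity R ≤ (omegaPlus R A).ncard :=
  Nat.sInf_le ⟨_, omegaPlus_isDisconnecting R hne huniv, rfl⟩

theorem arcConnectivity_le_ncard_omegaMinus {A : Set V} (hne : A.Nonempty)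
    (huniv : A ≠ Set.univ) : arcConnectivity R ≤ (omegaMinus R A).ncard := by
  rw [omegaMinus_eq_omegaPlus_compl]
  exact arcConnectivity_le_ncard_omegaPlus R (Set.nonempty_compl.2 huniv)
    (Set.compl_ne_univ.2 hne)

theorem ncard_omegaPlus_submodular [Finite V] (A B : Set V) :
    (omegaPlus R (A ∩ B)).ncard + (omegaPlus R (A ∪ B)).ncard ≤
      (omegaPlus R A).ncard + (omegaPlus R B).ncard := by
  rw [← Set.ncard_union_add_ncard_inter (omegaPlus R (A ∩ B)),
    ← Set.ncard_union_add_ncard_inter (omegaPlus R A)]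
  refine Nat.add_le_add (Set.ncard_le_ncard ?_) (Set.ncard_le_ncard ?_) <;>
  · intro p hp
    simp only [omegaPlus, Set.mem_union, Set.mem_inter_iff, Set.mem_ofPred_eq] at hp ⊢
    tauto

theorem ncard_omegaMinus_submodular [Finite V] (A B : Set V) :
    (omegaMinus R (A ∩ B)).ncard + (omegaMinus R (A ∪ B)).ncard ≤
      (omegaMinus R A).ncard + (omegaMinus R B).ncard := by
  simp only [omegaMinus_eq_omegaPlus_compl, Set.compl_inter, Set.compl_union]
  rw [add_comm]
  exact ncard_omegaPlus_submodular R Aᶜ Bᶜ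

theorem IsArcFragment.compl {A : Set V} (hA : IsArcFragment R A) : IsArcFragment R Aᶜ := by
  rcases hA with ⟨hne, huniv, hcard⟩ | ⟨hne, huniv, hcard⟩
  · exact .inr ⟨Set.nonempty_compl.2 huniv, Set.compl_ne_univ.2 hne, by
      rwa [omegaMinus_eq_omegaPlus_compl, compl_compl]⟩
  · exact .inl ⟨Set.nonempty_compl.2 huniv, Set.compl_ne_univ.2 hne, by
      rwa [← omegaMinus_eq_omegaPlus_compl]⟩

theorem ncard_omegaPlus_preimage (e : V ≃ V) (he : ∀ u v, R (e u) (e v) ↔ R u v) (A : Set V) :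
    (omegaPlus R (e ⁻¹' A)).ncard = (omegaPlus R A).ncard := by
  have h : omegaPlus R (e ⁻¹' A) = (e.prodCongr e) ⁻¹' omegaPlus R A := by
    ext p
    simp [omegaPlus, he]
  rw [h]
  exact Set.ncard_preimage_of_injective_subset_range (e.prodCongr e).injective (by simp)

theorem ncard_omegaMinus_preimage (e : V ≃ V) (he : ∀ u v, R (e u) (e v) ↔ R u v) (A : Set V) :
    (omegaMinus R (e ⁻¹' A)).ncard = (omegaMinus R A).ncard := by
  rw [omegaMinus_eq_omegaPlus_compl, omegaMinus_eq_omegaPlus_compl, ← Set.preimage_compl,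
    ncard_omegaPlus_preimage R e he]

/-- Minimizers of a submodular function which have least cardinality and contain at most half of
the points are equal as soon as they meet. -/
theorem eq_of_submodular_of_inter_nonempty [Finite V] {f : Set V → ℕ} {n : ℕ}
    (hsub : ∀ C D, f (C ∩ D) + f (C ∪ D) ≤ f C + f D)
    (hle : ∀ C : Set V, C.Nonempty → C ≠ Set.univ → n ≤ f C)
    {A B : Set V} (hA : f A = n) (hB : f B = n) (huniv : A ≠ Set.univ)
    (hmin : ∀ C : Set V, C.Nonempty → C ≠ Set.univ → f C = n → A.ncard ≤ C.ncard)
    (hhalf : A.ncard ≤ Aᶜ.ncard) (hAB : B.ncard = A.ncard) (hmeet : (A ∩ B).Nonempty) :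
    A = B := by
  have hsum := Set.ncard_union_add_ncard_inter A B
  have hpos := (Set.ncard_pos).2 hmeet
  have hunion : A ∪ B ≠ Set.univ := by
    intro h
    rw [h, Set.ncard_univ] at hsum
    have := Set.ncard_add_ncard_compl A
    omega
  have hinter : A ∩ B ≠ Set.univ := fun h => huniv (Set.univ_subset_iff.1 (h ▸ Set.inter_subset_left))
  have hle_inter := hle _ hmeet hinter
  have hle_union := hle _ (hmeet.mono (Set.inter_subset_left.trans Set.subset_union_left)) hunion
  have hcard := hmin _ hmeet hinter (by have := hsub A B; omega)
  have hsubset : A ⊆ B :=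
    Set.inter_eq_left.1 (Set.eq_of_subset_of_ncard_le Set.inter_subset_left hcard)
  exact Set.eq_of_subset_of_ncard_le hsubset hAB.le

theorem IsLambdaAtom.preimage_eq [Finite V] {A : Set V} (hA : IsLambdaAtom R A) (e : V ≃ V)
    (he : ∀ u v, R (e u) (e v) ↔ R u v) (hmeet : (A ∩ e ⁻¹' A).Nonempty) :
    e ⁻¹' A = A := by
  obtain ⟨hfrag, hmin⟩ := hA
  have hhalf := hmin _ (hfrag.compl R)
  have hcard : (e ⁻¹' A).ncard = A.ncard :=
    Set.ncard_preimage_of_injective_subset_range e.injective (by simp)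
  symm
  rcases hfrag with ⟨-, huniv, hn⟩ | ⟨-, huniv, hn⟩
  · exact eq_of_submodular_of_inter_nonempty (f := fun C => (omegaPlus R C).ncard)
      (ncard_omegaPlus_submodular R) (fun _ => arcConnectivity_le_ncard_omegaPlus R) hn
      ((ncard_omegaPlus_preimage R e he A).trans hn) huniv
      (fun C h1 h2 h3 => hmin C (.inl ⟨h1, h2, h3⟩)) hhalf hcard hmeet
  · exact eq_of_submodular_of_inter_nonempty (f := fun C => (omegaMinus R C).ncard)
      (ncard_omegaMinus_submodular R) (fun _ => arcConnectivity_le_ncard_omegaMinus R) hn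
      ((ncard_omegaMinus_preimage R e he A).trans hn) huniv
      (fun C h1 h2 h3 => hmin C (.inr ⟨h1, h2, h3⟩)) hhalf hcard hmeet

end Digraph

theorem MDArc_mul_right {G : Type*} [Group G] (S0 S1 T0 T1 : Set G) (h : G) (u v : G × Bool) :
    MDArc S0 S1 T0 T1 (u.1 * h, u.2) (v.1 * h, v.2) ↔ MDArc S0 S1 T0 T1 u v := by
  simp [MDArc, ← mul_assoc]

/-- if a λ-atom contains `(1_G, i)`, then `H_i = {g | (g,i) ∈ A}`
is a subgroup of `G`. -/
theorem mixedCayley_lambdaAtom_subgroup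
    {G : Type*} [Group G] [Fintype G] (S0 S1 T0 T1 : Set G)
    (hS0 : (1 : G) ∉ S0) (hS1 : (1 : G) ∉ S1)
    (hT0 : T0.Nonempty) (hT1 : T1.Nonempty)
    (hsc : DigraphStronglyConnected (MDArc S0 S1 T0 T1))
    (hlt : arcConnectivity (MDArc S0 S1 T0 T1) < minDegree (MDArc S0 S1 T0 T1))
    (A : Set (G × Bool)) (hA : IsLambdaAtom (MDArc S0 S1 T0 T1) A) :
    ∀ i : Bool, ((1 : G), i) ∈ A →
      ∃ H : Subgroup G, (H : Set G) = {g : G | (g, i) ∈ A} := by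
  intro i h1
  have hmul : ∀ h, (h, i) ∈ A → ∀ g, (g * h, i) ∈ A ↔ (g, i) ∈ A := by
    intro h hh g
    have heq := hA.preimage_eq _ ((Equiv.mulRight h).prodCongr (Equiv.refl Bool))
      (fun u v => MDArc_mul_right S0 S1 T0 T1 h u v) ⟨(1, i), h1, by simpa using hh⟩
    simpa using Set.ext_iff.1 heq (g, i)
  exact ⟨{ carrier := {g : G | (g, i) ∈ A}
           one_mem' := h1
           mul_mem' := fun {a b} ha hb => (hmul b hb a).2 ha
           inv_mem' := fun {a} ha => (hmul a ha a⁻¹).1 (by simpa using h1) }, rfl⟩
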